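/- arXiv:1601.04306 — 5 statements merged into one kernel-verified Lean document; each statement's English description precedes it below -/
import Mathlib

section
/- Let λ > 0 be a real number and set φ = λ/(1 − e^{−λ}). Then for any finite family of real numbers μ_1, …, μ_m with 0 ≤ μ_i ≤ 1 − e^{−λ} for each i, one has ∏_{i=1}^m (1 − μ_i) ≥ exp(−φ · ∑_{i=1}^m μ_i). -/
theorem stmt_1 (lam : ℝ) (hlam : 0 < lam) (m : ℕ) (μ : Fin m → ℝ)
    (hμ : ∀ i, 0 ≤ μ i ∧ μ i ≤ 1 - Real.exp (-lam)) :
    ∏ i, (1 - μ i) ≥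
      Real.exp (-(lam / (1 - Real.exp (-lam))) * ∑ i, μ i) := by
  have hc : 0 < 1 - Real.exp (-lam) := by
    have : Real.exp (-lam) < 1 := by simpa using hlam
    linarith
  rw [Finset.mul_sum, Real.exp_sum, ge_iff_le]
  refine Finset.prod_le_prod (fun i _ => (Real.exp_pos _).le) (fun i _ => ?_)
  obtain ⟨h0, h1⟩ := hμ i
  have ht0 : 0 ≤ μ i / (1 - Real.exp (-lam)) := by positivity
  have ht1 : μ i / (1 - Real.exp (-lam)) ≤ 1 := (div_le_one hc).2 h1
  have h := convexOn_exp.2 (Set.mem_univ (0:ℝ)) (Set.mem_univ (-lam))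
    (sub_nonneg.2 ht1) ht0 (by ring)
  simp only [smul_eq_mul, mul_zero, zero_add, Real.exp_zero, mul_one] at h
  have e1 : -(lam / (1 - Real.exp (-lam))) * μ i = μ i / (1 - Real.exp (-lam)) * -lam := by ring
  have e2 : μ i / (1 - Real.exp (-lam)) * (1 - Real.exp (-lam)) = μ i :=
    div_mul_cancel₀ _ hc.ne'
  rw [e1]
  linarith
end

section
/- For every integer d ≥ 3, every integer T ≥ 1, and all real numbers p_1, …, p_T ∈ [0,1], one has ∏_{i=1}^T (1 − d·p_i·exp(−(d−1)p_i)) ≥ exp(−∑_{i=1}^T 6·d·p_i·exp(−d·p_i)). -/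
theorem stmt_4_aux (d p : ℝ) (hd : 3 ≤ d) (h0 : 0 ≤ p) (h1 : p ≤ 1) :
    Real.exp (-(6 * d * p * Real.exp (-d * p))) ≤ 1 - d * p * Real.exp (-(d - 1) * p) := by
  have hE := Real.exp_pos (-(d - 1) * p)
  have e1 : Real.exp (-1) < 0.4 := by
    have := Real.exp_neg_one_lt_d9
    norm_num at this ⊢
    linarith
  have e2 : 1 / 3 < Real.exp (-1) := by
    have := Real.exp_neg_one_gt_d9
    norm_num at this ⊢
    linarith
  have hu : (d - 1) * p * Real.exp (-(d - 1) * p) ≤ Real.exp (-1) := by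
    have h := Real.add_one_le_exp ((d - 1) * p - 1)
    have h2 : Real.exp (-1) = Real.exp ((d - 1) * p - 1) * Real.exp (-(d - 1) * p) := by
      rw [← Real.exp_add]; ring_nf
    rw [h2]
    exact mul_le_mul_of_nonneg_right (by linarith) hE.le
  have hs : Real.exp (-d * p) = Real.exp (-(d - 1) * p) * Real.exp (-p) := by
    rw [← Real.exp_add]; ring_nf
  have hp : Real.exp (-1) ≤ Real.exp (-p) := Real.exp_le_exp.2 (by linarith)
  have hpE : 0 ≤ p * Real.exp (-(d - 1) * p) := by positivity
  obtain ⟨x, hx⟩ : ∃ x, x = d * p * Real.exp (-(d - 1) * p) := ⟨_, rfl⟩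
  have hx0 : 0 ≤ x := by rw [hx]; positivity
  have hx1 : x ≤ 0.6 := by
    have : d * (p * Real.exp (-(d - 1) * p)) ≤ 3 / 2 * (d - 1) * (p * Real.exp (-(d - 1) * p)) :=
      mul_le_mul_of_nonneg_right (by linarith) hpE
    rw [hx]; linarith
  have h6 : 6 * d * p * Real.exp (-d * p) = 6 * x * Real.exp (-p) := by rw [hs, hx]; ring
  rw [h6, ← hx]
  have h7 : Real.exp (-(6 * x * Real.exp (-p))) ≤ Real.exp (-(2 * x)) :=
    Real.exp_le_exp.2 (by nlinarith)
  refine h7.trans ?_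
  have h8 := Real.quadratic_le_exp_of_nonneg (x := 2 * x) (by linarith)
  rw [Real.exp_neg, inv_le_iff_one_le_mul₀ (Real.exp_pos _)]
  have h9 : (1 - x) * (1 + 2 * x + (2 * x) ^ 2 / 2) ≤ (1 - x) * Real.exp (2 * x) :=
    mul_le_mul_of_nonneg_left h8 (by norm_num at hx1; linarith)
  have h10 : x ^ 2 ≤ 1 / 2 := by norm_num at hx1; nlinarith
  nlinarith [mul_nonneg hx0 (sub_nonneg.2 h10)]

theorem stmt_4 (d : ℕ) (hd : 3 ≤ d) (T : ℕ) (hT : 1 ≤ T) (p : Fin T → ℝ)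
    (hp : ∀ i, 0 ≤ p i ∧ p i ≤ 1) :
    ∏ i, (1 - (d : ℝ) * p i * Real.exp (-((d : ℝ) - 1) * p i)) ≥
      Real.exp (-∑ i, 6 * (d : ℝ) * p i * Real.exp (-(d : ℝ) * p i)) := by
  rw [← Finset.sum_neg_distrib, Real.exp_sum]
  exact Finset.prod_le_prod (fun i _ => (Real.exp_pos _).le)
    (fun i _ => stmt_4_aux d (p i) (by exact_mod_cast hd) (hp i).1 (hp i).2)
end

section
/- For every integer N ≥ 3, every integer T ≥ 1, and all real numbers p_1, …, p_T ∈ [0,1], there exists an integer d with 3 ≤ d ≤ N such that ∑_{i=1}^T d·p_i·exp(−d·p_i) ≤ 2T / (∑_{j=3}^N 1/j). -/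
theorem aux_sum (p : ℝ) (hp : 0 ≤ p) (n : ℕ) (hn : 2 ≤ n) :
    ∑ d ∈ Finset.Icc 3 n, p * Real.exp (-(d : ℝ) * p) ≤ 1 - Real.exp (-(n : ℝ) * p) := by
  induction n, hn using Nat.le_induction with
  | base =>
    have : Real.exp (-((2 : ℕ) : ℝ) * p) ≤ 1 := Real.exp_le_one_iff.2 (by push_cast; linarith)
    simpa using this
  | succ n hn ih =>
    rw [Finset.sum_Icc_succ_top (by omega)]
    have h1 : Real.exp (-(n : ℝ) * p) = Real.exp p * Real.exp (-((n + 1 : ℕ) : ℝ) * p) := by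
      rw [← Real.exp_add]; congr 1; push_cast; ring
    have h2 := Real.add_one_le_exp p
    have h3 := Real.exp_pos (-((n + 1 : ℕ) : ℝ) * p)
    have h4 := mul_le_mul_of_nonneg_right h2 h3.le
    linarith

theorem stmt_7 (N : ℕ) (hN : 3 ≤ N) (T : ℕ) (hT : 1 ≤ T) (p : Fin T → ℝ)
    (hp : ∀ i, 0 ≤ p i ∧ p i ≤ 1) :
    ∃ d : ℕ, 3 ≤ d ∧ d ≤ N ∧
      ∑ i, (d : ℝ) * p i * Real.exp (-(d : ℝ) * p i) ≤
        2 * T / ∑ j ∈ Finset.Icc 3 N, (1 : ℝ) / j := by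
  by_contra! hc
  have hne : (Finset.Icc 3 N).Nonempty := ⟨3, by simp [hN]⟩
  have hpos : ∀ j ∈ Finset.Icc 3 N, (0 : ℝ) < 1 / j := by
    intro j hj
    have : 0 < j := by have := (Finset.mem_Icc.1 hj).1; omega
    positivity
  have hH := Finset.sum_pos hpos hne
  set H := ∑ j ∈ Finset.Icc 3 N, (1 : ℝ) / j with hHd
  have h1 : ∑ d ∈ Finset.Icc 3 N, (1 : ℝ) / d * (2 * T / H) ≤
      ∑ d ∈ Finset.Icc 3 N, ∑ i, p i * Real.exp (-(d : ℝ) * p i) := by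
    apply Finset.sum_le_sum
    intro d hd
    have h := hc d (Finset.mem_Icc.1 hd).1 (Finset.mem_Icc.1 hd).2
    have hd0 : (d : ℝ) ≠ 0 := by
      have := (Finset.mem_Icc.1 hd).1
      exact_mod_cast (by omega : d ≠ 0)
    refine (mul_le_mul_of_nonneg_left h.le (hpos d hd).le).trans (le_of_eq ?_)
    rw [Finset.mul_sum]
    refine Finset.sum_congr rfl fun i _ => ?_
    field_simp
  rw [← Finset.sum_mul, ← hHd, mul_div_cancel₀ _ hH.ne', Finset.sum_comm] at h1
  have h2 : ∑ i : Fin T, ∑ d ∈ Finset.Icc 3 N, p i * Real.exp (-(d : ℝ) * p i) ≤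
      ∑ i : Fin T, (1 : ℝ) := by
    apply Finset.sum_le_sum
    intro i _
    have := aux_sum (p i) (hp i).1 N (by omega)
    have := Real.exp_pos (-(N : ℝ) * p i)
    linarith
  have hT' : (1 : ℝ) ≤ T := by exact_mod_cast hT
  simp only [Finset.sum_const, Finset.card_univ, Fintype.card_fin, nsmul_eq_mul, mul_one] at h2
  linarith
end

section
/- There exists a constant κ > 0 such that the following holds: for every ε > 0 there exists N such that for all n ≥ N, for every sequence p_1, p_2, p_3, … of real numbers in [0,1], and for T = ⌊κ·(log n)²⌋, one has ∏_{d=1}^{⌊n^{1/3}⌋} (1 − ∏_{i=1}^{T} (1 − d·p_i·(1−p_i)^{d−1}))^{⌊n^{1/3}⌋} ≤ ε. -/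
lemma aux_pow (u : ℝ) (hu : 0 ≤ u) (d : ℕ) :
    1 + d * u + (d:ℝ) * (d - 1) / 2 * u ^ 2 ≤ (1 + u) ^ d := by
  induction d with
  | zero => simp
  | succ k ih =>
    have h := mul_le_mul_of_nonneg_right ih (by linarith : (0:ℝ) ≤ 1 + u)
    rw [pow_succ]
    refine le_trans ?_ h
    push_cast
    have hk : (0:ℝ) ≤ (k:ℝ) * (k - 1) := by
      rcases Nat.eq_zero_or_pos k with h0 | h0
      · simp [h0]
      · have : (1:ℝ) ≤ k := by exact_mod_cast h0
        exact mul_nonneg (by linarith) (by linarith)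
    have : 0 ≤ (k:ℝ) * (k - 1) * u ^ 3 := mul_nonneg hk (by positivity)
    nlinarith

lemma aux_half (p : ℝ) (h0 : 0 ≤ p) (h1 : p ≤ 1) (d : ℕ) (hd : 2 ≤ d) :
    (d : ℝ) * p * (1 - p) ^ (d - 1) ≤ 1 / 2 := by
  rcases eq_or_lt_of_le h1 with h | h
  · subst h
    rw [sub_self, zero_pow (by omega)]; norm_num
  · have ha : 0 < 1 - p := by linarith
    have hu : 0 ≤ p / (1 - p) := by positivity
    have key := aux_pow (p / (1 - p)) hu d
    have e1 : 1 + p / (1 - p) = (1 - p)⁻¹ := by field_simp; ring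
    set u := p / (1 - p) with hudef
    have hd' : (2:ℝ) ≤ d := by exact_mod_cast hd
    have k2 : 2 * (d * u) ≤ (1 + u) ^ d := by
      nlinarith [sq_nonneg (1 - d * u / 2), mul_nonneg (mul_nonneg (by linarith : (0:ℝ) ≤ d) (by linarith : (0:ℝ) ≤ (d:ℝ) - 2)) (sq_nonneg u)]
    rw [e1, inv_pow] at k2
    have hp : 0 < (1 - p) ^ d := by positivity
    have k3 := mul_le_mul_of_nonneg_right k2 hp.le
    rw [inv_mul_cancel₀ hp.ne'] at k3
    have e2 : (1 - p) ^ d = (1 - p) ^ (d - 1) * (1 - p) := by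
      rw [← pow_succ]; congr 1; omega
    have e3 : u * (1 - p) = p := by rw [hudef]; field_simp
    have : 2 * (d * u) * (1 - p) ^ d = 2 * (d * p * (1 - p) ^ (d - 1)) := by
      rw [e2]; linear_combination 2 * d * (1 - p) ^ (d - 1) * e3
    linarith

lemma aux_exp (x : ℝ) (h0 : 0 ≤ x) (h1 : x ≤ 1 / 2) : Real.exp (-(2 * x)) ≤ 1 - x := by
  rw [Real.exp_neg]
  have h := Real.add_one_le_exp (2 * x)
  rw [inv_le_comm₀ (Real.exp_pos _) (by linarith)]
  refine le_trans ?_ h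
  rw [inv_le_iff_one_le_mul₀ (by linarith)]
  nlinarith

lemma aux_geom (p : ℝ) (h0 : 0 ≤ p) (h1 : p ≤ 1) (m : ℕ) :
    ∑ d ∈ Finset.Icc 2 m, p * (1 - p) ^ (d - 1) ≤ 1 := by
  have h2 : ∑ d ∈ Finset.Icc 2 m, p * (1 - p) ^ (d - 1) ≤
      ∑ d ∈ Finset.Icc 1 m, p * (1 - p) ^ (d - 1) := by
    apply Finset.sum_le_sum_of_subset_of_nonneg
    · exact Finset.Icc_subset_Icc_left (by norm_num)
    · intro i _ _
      exact mul_nonneg h0 (pow_nonneg (by linarith) _)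
  have h3 : ∀ m : ℕ, ∑ d ∈ Finset.Icc 1 m, p * (1 - p) ^ (d - 1) = 1 - (1 - p) ^ m := by
    intro m
    induction m with
    | zero => simp
    | succ k ih =>
      rw [Finset.sum_Icc_succ_top (by omega), ih, Nat.add_sub_cancel]; ring
  rw [h3] at h2
  have := pow_nonneg (by linarith : (0:ℝ) ≤ 1 - p) m
  linarith

lemma aux_exists (p : ℕ → ℝ) (hp : ∀ i, 0 ≤ p i ∧ p i ≤ 1) (m T : ℕ) (L S : ℝ) (hL : 0 < L)
    (hm : L ≤ Real.log ((m + 1 : ℕ) : ℝ) - 1) (hT : (T : ℝ) ≤ S * L) :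
    ∃ d ∈ Finset.Icc 2 m,
      ∑ i ∈ Finset.Icc 1 T, (d : ℝ) * p i * (1 - p i) ^ (d - 1) ≤ S := by
  by_contra! hcon
  have hH : L ≤ ∑ d ∈ Finset.Icc 2 m, (d : ℝ)⁻¹ := by
    have h1 := log_add_one_le_harmonic m
    rw [harmonic_eq_sum_Icc] at h1
    have hm1 : 1 ≤ m := by
      by_contra h
      have : m = 0 := by omega
      subst this
      simp at hm
      linarith
    rw [← Finset.add_sum_Ioc_eq_sum_Icc hm1] at h1
    push_cast at h1 hm
    have : Finset.Icc 2 m = Finset.Ioc 1 m := rfl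
    rw [this]
    norm_num at h1
    linarith
  have hne : (Finset.Icc 2 m).Nonempty := by
    rw [Finset.nonempty_iff_ne_empty]
    intro h
    rw [h] at hH
    simp at hH
    linarith
  have hS : 0 ≤ S := by
    by_contra h
    have : (0:ℝ) ≤ T := by positivity
    nlinarith
  have hlt : ∑ d ∈ Finset.Icc 2 m, (d : ℝ)⁻¹ * S <
      ∑ d ∈ Finset.Icc 2 m, (d : ℝ)⁻¹ *
        ∑ i ∈ Finset.Icc 1 T, (d : ℝ) * p i * (1 - p i) ^ (d - 1) := by
    apply Finset.sum_lt_sum_of_nonempty hne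
    intro d hd
    have : 0 < (d:ℝ) := by
      have := (Finset.mem_Icc.1 hd).1
      exact_mod_cast (by omega : 0 < d)
    exact mul_lt_mul_of_pos_left (hcon d hd) (by positivity)
  have hle : ∑ d ∈ Finset.Icc 2 m, (d : ℝ)⁻¹ *
        ∑ i ∈ Finset.Icc 1 T, (d : ℝ) * p i * (1 - p i) ^ (d - 1) ≤ T := by
    have e : ∑ d ∈ Finset.Icc 2 m, (d : ℝ)⁻¹ *
        ∑ i ∈ Finset.Icc 1 T, (d : ℝ) * p i * (1 - p i) ^ (d - 1) =
        ∑ i ∈ Finset.Icc 1 T, ∑ d ∈ Finset.Icc 2 m, p i * (1 - p i) ^ (d - 1) := by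
      rw [Finset.sum_comm]
      apply Finset.sum_congr rfl
      intro d hd
      rw [Finset.mul_sum]
      apply Finset.sum_congr rfl
      intro i _
      have : (d:ℝ) ≠ 0 := by
        have := (Finset.mem_Icc.1 hd).1
        exact_mod_cast (by omega : d ≠ 0)
      field_simp
    rw [e]
    calc _ ≤ ∑ i ∈ Finset.Icc 1 T, (1:ℝ) :=
          Finset.sum_le_sum fun i _ => aux_geom (p i) (hp i).1 (hp i).2 m
      _ = T := by simp
  rw [← Finset.sum_mul] at hlt
  nlinarith

lemma aux_q (p : ℝ) (h0 : 0 ≤ p) (h1 : p ≤ 1) (d : ℕ) (hd : 1 ≤ d) :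
    0 ≤ (d : ℝ) * p * (1 - p) ^ (d - 1) ∧ (d : ℝ) * p * (1 - p) ^ (d - 1) ≤ 1 := by
  constructor
  · exact mul_nonneg (by positivity) (pow_nonneg (by linarith) _)
  · rcases eq_or_lt_of_le hd with h | h
    · subst h; simpa using h1
    · linarith [aux_half p h0 h1 d h]

theorem stmt_8 :
    ∃ κ : ℝ, 0 < κ ∧ ∀ ε : ℝ, 0 < ε → ∃ N : ℕ, ∀ n : ℕ, N ≤ n →
      ∀ p : ℕ → ℝ, (∀ i, 0 ≤ p i ∧ p i ≤ 1) →
        ∏ d ∈ Finset.Icc 1 ⌊(n : ℝ) ^ ((1 : ℝ) / 3)⌋₊,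
          (1 - ∏ i ∈ Finset.Icc 1 ⌊κ * Real.log n ^ 2⌋₊,
            (1 - (d : ℝ) * p i * (1 - p i) ^ (d - 1))) ^ ⌊(n : ℝ) ^ ((1 : ℝ) / 3)⌋₊
        ≤ ε := by
  refine ⟨1 / 72, by norm_num, fun ε hε => ?_⟩
  have t1 : Filter.Tendsto (fun n : ℕ => Real.log (n:ℝ)) Filter.atTop Filter.atTop :=
    Real.tendsto_log_atTop.comp tendsto_natCast_atTop_atTop
  have t2 : Filter.Tendsto (fun n : ℕ => (n:ℝ) ^ ((1:ℝ) / 6)) Filter.atTop Filter.atTop :=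
    (tendsto_rpow_atTop (by norm_num)).comp tendsto_natCast_atTop_atTop
  obtain ⟨N, hN⟩ := Filter.eventually_atTop.1
    (((t1.eventually_ge_atTop 6).and (t2.eventually_ge_atTop (-2 * Real.log ε))).and
      ((t2.eventually_ge_atTop 2).and (Filter.eventually_ge_atTop 1)))
  refine ⟨N, fun n hn p hp => ?_⟩
  obtain ⟨⟨hlog, heps⟩, h2, hn1⟩ := hN n hn
  have hnpos : (0:ℝ) < n := by exact_mod_cast hn1
  have hsq : (n:ℝ) ^ ((1:ℝ) / 3) = (n:ℝ) ^ ((1:ℝ) / 6) * (n:ℝ) ^ ((1:ℝ) / 6) := by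
    rw [← Real.rpow_add hnpos]; norm_num
  set x := (n:ℝ) ^ ((1:ℝ) / 6) with hx
  set m := ⌊(n : ℝ) ^ ((1 : ℝ) / 3)⌋₊ with hmdef
  set T := ⌊1 / 72 * Real.log n ^ 2⌋₊ with hTdef
  have hm1 : (n : ℝ) ^ ((1 : ℝ) / 3) < m + 1 := Nat.lt_floor_add_one _
  have hmx : x / 2 * x ≤ m := by rw [hsq] at hm1; nlinarith
  have hlogm : Real.log n / 6 ≤ Real.log ((m + 1 : ℕ) : ℝ) - 1 := by
    have : Real.log ((n : ℝ) ^ ((1 : ℝ) / 3)) ≤ Real.log ((m + 1 : ℕ) : ℝ) := by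
      apply Real.log_le_log (by positivity)
      push_cast; exact hm1.le
    rw [Real.log_rpow hnpos] at this
    linarith
  have hT : (T : ℝ) ≤ (Real.log n / 12) * (Real.log n / 6) := by
    have : (T : ℝ) ≤ 1 / 72 * Real.log n ^ 2 := Nat.floor_le (by positivity)
    linarith
  obtain ⟨d, hd, hsum⟩ := aux_exists p hp m T _ _ (by linarith) hlogm hT
  obtain ⟨hd2, hdm⟩ := Finset.mem_Icc.1 hd
  have hB : ∀ e ∈ Finset.Icc 1 m,
      0 ≤ 1 - ∏ i ∈ Finset.Icc 1 T, (1 - (e : ℝ) * p i * (1 - p i) ^ (e - 1)) ∧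
      1 - ∏ i ∈ Finset.Icc 1 T, (1 - (e : ℝ) * p i * (1 - p i) ^ (e - 1)) ≤ 1 := by
    intro e he
    have hq := fun i => aux_q (p i) (hp i).1 (hp i).2 e (Finset.mem_Icc.1 he).1
    have a1 := Finset.prod_nonneg (s := Finset.Icc 1 T)
      (f := fun i => 1 - (e : ℝ) * p i * (1 - p i) ^ (e - 1))
      (fun i _ => by linarith [(hq i).2])
    have a2 := Finset.prod_le_one (s := Finset.Icc 1 T)
      (f := fun i => 1 - (e : ℝ) * p i * (1 - p i) ^ (e - 1))
      (fun i _ => by linarith [(hq i).2]) (fun i _ => by linarith [(hq i).1])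
    constructor <;> linarith
  have hd1 : d ∈ Finset.Icc 1 m := Finset.mem_Icc.2 ⟨by omega, hdm⟩
  rw [← Finset.mul_prod_erase _ _ hd1]
  have hrest : ∏ e ∈ (Finset.Icc 1 m).erase d,
      (1 - ∏ i ∈ Finset.Icc 1 T, (1 - (e : ℝ) * p i * (1 - p i) ^ (e - 1))) ^ m ≤ 1 := by
    apply Finset.prod_le_one
    · intro e he
      exact pow_nonneg (hB e (Finset.mem_of_mem_erase he)).1 _
    · intro e he
      have := hB e (Finset.mem_of_mem_erase he)
      exact pow_le_one₀ this.1 this.2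
  refine le_trans (mul_le_of_le_one_right (pow_nonneg (hB d hd1).1 _) hrest) ?_
  have hprod : x⁻¹ ≤ ∏ i ∈ Finset.Icc 1 T, (1 - (d : ℝ) * p i * (1 - p i) ^ (d - 1)) := by
    calc x⁻¹ = Real.exp (-(2 * (Real.log n / 12))) := by
          rw [hx, ← Real.rpow_neg hnpos.le, Real.rpow_def_of_pos hnpos]; congr 1; ring
      _ ≤ Real.exp (∑ i ∈ Finset.Icc 1 T, -(2 * ((d : ℝ) * p i * (1 - p i) ^ (d - 1)))) := by
          rw [Finset.sum_neg_distrib, ← Finset.mul_sum]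
          apply Real.exp_le_exp.2; linarith
      _ = ∏ i ∈ Finset.Icc 1 T, Real.exp (-(2 * ((d : ℝ) * p i * (1 - p i) ^ (d - 1)))) :=
          Real.exp_sum _ _
      _ ≤ _ := by
          apply Finset.prod_le_prod
          · intro i _; exact (Real.exp_pos _).le
          · intro i _
            exact aux_exp _ (aux_q (p i) (hp i).1 (hp i).2 d (by omega)).1
              (aux_half (p i) (hp i).1 (hp i).2 d hd2)
  have hbase : 1 - ∏ i ∈ Finset.Icc 1 T, (1 - (d : ℝ) * p i * (1 - p i) ^ (d - 1))
      ≤ Real.exp (-x⁻¹) := by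
    have := Real.add_one_le_exp (-x⁻¹)
    linarith
  refine le_trans (pow_le_pow_left₀ (hB d hd1).1 hbase m) ?_
  rw [← Real.exp_nat_mul, ← Real.le_log_iff_exp_le hε]
  have hxpos : 0 < x := by linarith
  have : x / 2 ≤ m * x⁻¹ := by
    rw [← div_eq_mul_inv, le_div_iff₀ hxpos]; exact hmx
  linarith
end

section
/- Let a > 1, r ≥ 1, β > 0 and M ≥ a·β be real numbers, and let μ : ℕ → ℝ be a sequence of nonnegative reals with μ_0 ≤ M such that for every t ≥ 0, either μ_{t+1} ≤ a^{−1/r}·μ_t (call step t 'blue') or μ_{t+1} ≤ a·μ_t (call step t 'red'). Fix T ≥ 1 and suppose that at most R of the steps t ∈ {0, 1, …, T−1} are red. Then the number of indices t ∈ {1, …, T} with μ_t > a·β is at most (1 + r)·R + r·log_a(M/(a·β)). -/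
theorem stmt_12 (a r β M : ℝ) (ha : 1 < a) (hr : 1 ≤ r) (hβ : 0 < β) (hM : a * β ≤ M)
    (μ : ℕ → ℝ) (hμ : ∀ t, 0 ≤ μ t) (hμ0 : μ 0 ≤ M)
    (red : ℕ → Prop) [DecidablePred red]
    (hred : ∀ t, red t → μ (t + 1) ≤ a * μ t)
    (hblue : ∀ t, ¬red t → μ (t + 1) ≤ a ^ (-(1 / r)) * μ t)
    (T : ℕ) (hT : 1 ≤ T) (R : ℝ)
    (hR : (((Finset.range T).filter red).card : ℝ) ≤ R) :
    ((((Finset.Icc 1 T).filter fun t => a * β < μ t).card : ℝ)) ≤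
      (1 + r) * R + r * Real.logb a (M / (a * β)) := by
  have ha0 : 0 < a := by linarith
  have hc : 0 < a * β := by positivity
  have hr0 : 0 < r := by linarith
  set c := a * β with hcdef
  clear_value c
  have hpos : ∀ t, 0 < max (μ t) c := fun t => lt_max_of_lt_right hc
  have key : ∀ n : ℕ, (((Finset.Icc 1 n).filter fun t => c < μ t).card : ℝ)
      + r * Real.logb a (max (μ n) c)
      ≤ (1 + r) * (((Finset.range n).filter red).card : ℝ) + r * Real.logb a M := by
    intro n
    induction n with
    | zero =>
      have : Real.logb a (max (μ 0) c) ≤ Real.logb a M :=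
        Real.logb_le_logb_of_le ha (hpos 0) (max_le hμ0 hM)
      simp
      exact mul_le_mul_of_nonneg_left this hr0.le
    | succ n ih =>
      rw [← Finset.insert_Icc_right_eq_Icc_add_one (by omega), Finset.filter_insert,
        Finset.range_add_one, Finset.filter_insert]
      have hn1 : n + 1 ∉ (Finset.Icc 1 n).filter fun t => c < μ t := by simp
      have hn2 : n ∉ (Finset.range n).filter red := by simp
      by_cases h : red n
      · have h1 : Real.logb a (max (μ (n+1)) c) ≤ 1 + Real.logb a (max (μ n) c) := by
          have : Real.logb a (a * max (μ n) c) = 1 + Real.logb a (max (μ n) c) := by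
            rw [Real.logb_mul ha0.ne' (hpos n).ne', Real.logb_self_eq_one ha]
          rw [← this]
          apply Real.logb_le_logb_of_le ha (hpos _)
          apply max_le
          · exact (hred n h).trans (mul_le_mul_of_nonneg_left (le_max_left _ _) ha0.le)
          · nlinarith [le_max_right (μ n) c]
        have h2 := mul_le_mul_of_nonneg_left h1 hr0.le
        rw [if_pos h, Finset.card_insert_of_notMem hn2]
        split_ifs
        · rw [Finset.card_insert_of_notMem hn1]
          push_cast
          linarith
        · push_cast
          linarith
      · rw [if_neg h]
        split_ifs with h3
        · rw [Finset.card_insert_of_notMem hn1]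
          have h1 : Real.logb a (max (μ (n+1)) c) ≤ -(1 / r) + Real.logb a (max (μ n) c) := by
            have hp : 0 < a ^ (-(1 / r)) := Real.rpow_pos_of_pos ha0 _
            have : Real.logb a (a ^ (-(1 / r)) * max (μ n) c)
                = -(1 / r) + Real.logb a (max (μ n) c) := by
              rw [Real.logb_mul hp.ne' (hpos n).ne', Real.logb_rpow ha0 ha.ne']
            rw [← this]
            apply Real.logb_le_logb_of_le ha (hpos _)
            rw [max_eq_left h3.le]
            exact (hblue n h).trans (mul_le_mul_of_nonneg_left (le_max_left _ _) hp.le)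
          have h2 := mul_le_mul_of_nonneg_left h1 hr0.le
          have h4 : r * (1 / r) = 1 := by field_simp
          push_cast
          linarith
        · have h1 : Real.logb a (max (μ (n+1)) c) ≤ Real.logb a (max (μ n) c) := by
            apply Real.logb_le_logb_of_le ha (hpos _)
            rw [max_eq_right (not_lt.mp h3)]
            exact le_max_right _ _
          have h2 := mul_le_mul_of_nonneg_left h1 hr0.le
          linarith
  have hk := key T
  have h1 : Real.logb a c ≤ Real.logb a (max (μ T) c) :=
    Real.logb_le_logb_of_le ha hc (le_max_right _ _)
  have h2 := mul_le_mul_of_nonneg_left h1 hr0.le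
  have h3 : (1 + r) * (((Finset.range T).filter red).card : ℝ) ≤ (1 + r) * R :=
    mul_le_mul_of_nonneg_left hR (by linarith)
  rw [Real.logb_div (by linarith) hc.ne']
  linarith
end
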